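/- For every integer n ≥ 3, L_{n,4} = C(3(n-1)n/2, 4) - [3(6n-11)(n-2) + (3/2)(n-2)(10n^3-20n^2-47n+95) + (3/8)(n-2)(9n^5-18n^4-96n^3+198n^2+235n-520)] = (3/128)(n-2)(n-3)(9n^6+9n^5-135n^4-81n^3+670n^2+104n-1216). -/

import Mathlib

open Finset

/-- The three edges of the upward unit triangle with lower-left corner `p`. -/
def upTri (p : ℕ × ℕ) : Finset (Sym2 (ℕ × ℕ)) :=
  {s(p, (p.1 + 1, p.2)), s(p, (p.1, p.2 + 1)), s((p.1 + 1, p.2), (p.1, p.2 + 1))}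

/-- The three edges of the downward unit triangle associated to `p`. -/
def downTri (p : ℕ × ℕ) : Finset (Sym2 (ℕ × ℕ)) :=
  {s((p.1 + 1, p.2), (p.1, p.2 + 1)), s((p.1 + 1, p.2), (p.1 + 1, p.2 + 1)),
    s((p.1, p.2 + 1), (p.1 + 1, p.2 + 1))}

/-- The upward-pointing unit triangles of the triangular grid of side `n`. -/
def upTris (n : ℕ) : Finset (Finset (Sym2 (ℕ × ℕ))) :=
  ((Finset.range n ×ˢ Finset.range n).filter (fun p => p.1 + p.2 + 1 ≤ n)).image upTri

/-- The downward-pointing unit triangles of the triangular grid of side `n`. -/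
def downTris (n : ℕ) : Finset (Finset (Sym2 (ℕ × ℕ))) :=
  ((Finset.range n ×ˢ Finset.range n).filter (fun p => p.1 + p.2 + 2 ≤ n)).image downTri

/-- All unit triangles (each given as its set of three edges). -/
def unitTris (n : ℕ) : Finset (Finset (Sym2 (ℕ × ℕ))) := upTris n ∪ downTris n

/-- All edges of the triangular grid of side `n`. -/
def allEdges (n : ℕ) : Finset (Sym2 (ℕ × ℕ)) := (unitTris n).sup id

/-- The internal edges: edges belonging to two unit triangles. -/
def internalEdges (n : ℕ) : Finset (Sym2 (ℕ × ℕ)) :=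
  (allEdges n).filter (fun e => 2 ≤ ((unitTris n).filter (fun t => e ∈ t)).card)

/-- A lozenge tiling: a set of internal edges, no two in a common unit triangle. -/
def IsLozengeTiling (n : ℕ) (S : Finset (Sym2 (ℕ × ℕ))) : Prop :=
  S ⊆ internalEdges n ∧ ∀ t ∈ unitTris n, (t ∩ S).card ≤ 1

/-- `L n l`: the number of lozenge tilings of the side-`n` triangle with `l` lozenges. -/
def L (n l : ℕ) : ℕ :=
  (((internalEdges n).powersetCard l).filter
    (fun S => ∀ t ∈ unitTris n, (t ∩ S).card ≤ 1)).card

/-- Ordered quadruples of pairwise non-adjacent vertices, reduced to a sum over ordered pairs. -/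
lemma sum_quadruples_eq_sum_pairs {ι : Type*} (X : Finset ι) (A κ : ι → ι → ℚ) (c : ι → ℚ)
    (m : ℚ) (hm : ∑ _a ∈ X, (1 : ℚ) = m) (hc : ∀ a, ∑ b ∈ X, A a b = c a)
    (hκ : ∀ a b, ∑ d ∈ X, A a d * A b d = κ a b) (hsymm : ∀ a b, A a b = A b a)
    (htriple : ∀ a ∈ X, ∀ b ∈ X, ∀ e ∈ X, ∀ d ∈ X,
      (1 - A a b) * (1 - A a e) * (1 - A b e) * (A a d * A b d * A e d) = 0) :
    ∑ a ∈ X, ∑ b ∈ X, ∑ e ∈ X, ∑ d ∈ X, (1 - A a b) * (1 - A a e) * (1 - A b e) *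
        ((1 - A a d) * (1 - A b d) * (1 - A e d)) =
      ∑ a ∈ X, ∑ b ∈ X, (1 - A a b) *
        ((m - 3 * c a + 3 * κ a b) * (m - c a - c b + κ a b)) := by
  have inner : ∀ a ∈ X, ∀ b ∈ X, ∀ e ∈ X,
      ∑ d ∈ X, (1 - A a b) * (1 - A a e) * (1 - A b e) *
        ((1 - A a d) * (1 - A b d) * (1 - A e d)) =
      (1 - A a b) * (1 - A a e) * (1 - A b e) *
        (m - c a - c b - c e + κ a b + κ a e + κ b e) := by
    intro a ha b hb e he
    rw [← hm, ← hc, ← hc, ← hc, ← hκ, ← hκ, ← hκ, ← sum_sub_distrib, ← sum_sub_distrib,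
      ← sum_sub_distrib, ← sum_add_distrib, ← sum_add_distrib, ← sum_add_distrib, mul_sum]
    refine sum_congr rfl fun d hd ↦ ?_
    linear_combination -(htriple a ha b hb e he d hd)
  rw [sum_congr rfl fun a ha ↦ sum_congr rfl fun b hb ↦ sum_congr rfl (inner a ha b hb)]
  have pair : ∀ a b, ∑ e ∈ X, (1 - A a e) * (1 - A b e) = m - c a - c b + κ a b := by
    intro a b
    rw [← hm, ← hc, ← hc, ← hκ, ← sum_sub_distrib, ← sum_sub_distrib, ← sum_add_distrib]
    exact sum_congr rfl fun d _ ↦ by ring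
  have swap₁ : ∀ f : ι → ι → ι → ℚ, ∑ a ∈ X, ∑ b ∈ X, ∑ e ∈ X,
      (1 - A a b) * (1 - A a e) * (1 - A b e) * f a b e =
      ∑ a ∈ X, ∑ b ∈ X, ∑ e ∈ X, (1 - A a b) * (1 - A a e) * (1 - A b e) * f b a e := by
    intro f
    rw [sum_comm]
    refine sum_congr rfl fun a _ ↦ sum_congr rfl fun b _ ↦ sum_congr rfl fun e _ ↦ ?_
    rw [hsymm b a]; ring
  have swap₂ : ∀ f : ι → ι → ι → ℚ, ∑ a ∈ X, ∑ b ∈ X, ∑ e ∈ X,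
      (1 - A a b) * (1 - A a e) * (1 - A b e) * f a b e =
      ∑ a ∈ X, ∑ b ∈ X, ∑ e ∈ X, (1 - A a b) * (1 - A a e) * (1 - A b e) * f a e b := by
    intro f
    refine sum_congr rfl fun a _ ↦ ?_
    rw [sum_comm]
    refine sum_congr rfl fun b _ ↦ sum_congr rfl fun e _ ↦ ?_
    rw [hsymm e b]; ring
  have hb := swap₁ fun _ b _ ↦ c b
  have he := swap₂ fun _ _ e ↦ c e
  have hae := swap₂ fun a _ e ↦ κ a e
  have hbe := swap₁ fun _ b e ↦ κ b e
  have expand : ∑ a ∈ X, ∑ b ∈ X, ∑ e ∈ X, (1 - A a b) * (1 - A a e) * (1 - A b e) *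
        (m - c a - c b - c e + κ a b + κ a e + κ b e) =
      ∑ a ∈ X, ∑ b ∈ X, ∑ e ∈ X, (1 - A a b) * (1 - A a e) * (1 - A b e) *
        (m - 3 * c a + 3 * κ a b) := by
    have split : ∀ a b e, (1 - A a b) * (1 - A a e) * (1 - A b e) *
        (m - c a - c b - c e + κ a b + κ a e + κ b e) =
        (1 - A a b) * (1 - A a e) * (1 - A b e) * (m - 3 * c a + 3 * κ a b)
        + ((1 - A a b) * (1 - A a e) * (1 - A b e) * c a
          - (1 - A a b) * (1 - A a e) * (1 - A b e) * c b)
        + ((1 - A a b) * (1 - A a e) * (1 - A b e) * c a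
          - (1 - A a b) * (1 - A a e) * (1 - A b e) * c e)
        + ((1 - A a b) * (1 - A a e) * (1 - A b e) * κ a e
          - (1 - A a b) * (1 - A a e) * (1 - A b e) * κ a b)
        + ((1 - A a b) * (1 - A a e) * (1 - A b e) * κ b e
          - (1 - A a b) * (1 - A a e) * (1 - A b e) * κ a b) := fun a b e ↦ by ring
    simp only [split, sum_add_distrib, sum_sub_distrib]
    linarith
  rw [expand]
  refine sum_congr rfl fun a _ ↦ sum_congr rfl fun b _ ↦ ?_
  rw [← pair, mul_sum, mul_sum]
  exact sum_congr rfl fun _ _ ↦ by ring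

/-- The pair sum of `sum_quadruples_eq_sum_pairs` as a sum over single vertices, when two
non-adjacent vertices have at most one common neighbour. -/
lemma sum_pairs_eq_sum {ι : Type*} (X : Finset ι) (A κ : ι → ι → ℚ) (c K R : ι → ℚ)
    (m : ℚ) (hm : ∑ _a ∈ X, (1 : ℚ) = m) (hc : ∀ a, ∑ b ∈ X, A a b = c a)
    (hR : ∀ a, ∑ b ∈ X, A a b * c b = R a)
    (hK : ∀ a, ∑ b ∈ X, (1 - A a b) * κ a b = K a)
    (hsymm : ∀ a b, A a b = A b a) (hκs : ∀ a b, κ a b = κ b a)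
    (hsq : ∀ a ∈ X, ∀ b ∈ X, (1 - A a b) * κ a b ^ 2 = (1 - A a b) * κ a b) :
    ∑ a ∈ X, ∑ b ∈ X, (1 - A a b) *
        ((m - 3 * c a + 3 * κ a b) * (m - c a - c b + κ a b)) =
      ∑ a ∈ X, ((m ^ 2 - 5 * m * c a + 3 * c a ^ 2) * (m - c a) +
        3 * c a * (∑ b ∈ X, c b - R a) + (4 * m + 3 - 9 * c a) * K a) := by
  have swap : ∀ f : ι → ι → ℚ, ∑ a ∈ X, ∑ b ∈ X, (1 - A a b) * f a b =
      ∑ a ∈ X, ∑ b ∈ X, (1 - A a b) * f b a := by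
    intro f
    rw [sum_comm]
    exact sum_congr rfl fun a _ ↦ sum_congr rfl fun b _ ↦ by rw [hsymm b a]
  have h := swap fun a b ↦ -m * c b - 3 * (κ a b * c b)
  have e : ∀ a ∈ X, (m ^ 2 - 5 * m * c a + 3 * c a ^ 2) * (m - c a) +
        3 * c a * (∑ b ∈ X, c b - R a) + (4 * m + 3 - 9 * c a) * K a =
      ∑ b ∈ X, (1 - A a b) * (m ^ 2 - 5 * m * c a + 3 * c a ^ 2 + 3 * c a * c b
        + (4 * m + 3 - 9 * c a) * κ a b) := by
    intro a _
    have split : ∀ b, (1 - A a b) * (m ^ 2 - 5 * m * c a + 3 * c a ^ 2 + 3 * c a * c b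
        + (4 * m + 3 - 9 * c a) * κ a b) =
        (m ^ 2 - 5 * m * c a + 3 * c a ^ 2) * 1 - (m ^ 2 - 5 * m * c a + 3 * c a ^ 2) * A a b
        + (3 * c a * c b - 3 * c a * (A a b * c b))
        + (4 * m + 3 - 9 * c a) * ((1 - A a b) * κ a b) := fun b ↦ by ring
    simp only [split, sum_add_distrib, sum_sub_distrib, ← mul_sum, hm, hc, hR, hK]
    ring
  rw [sum_congr rfl e]
  have split : ∀ a ∈ X, ∀ b ∈ X, (1 - A a b) *
        ((m - 3 * c a + 3 * κ a b) * (m - c a - c b + κ a b)) =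
      (1 - A a b) * (m ^ 2 - 5 * m * c a + 3 * c a ^ 2 + 3 * c a * c b
        + (4 * m + 3 - 9 * c a) * κ a b)
      + ((1 - A a b) * (-m * c b - 3 * (κ a b * c b))
        - (1 - A a b) * (-m * c a - 3 * (κ b a * c a))) := by
    intro a ha b hb
    rw [hκs b a]
    linear_combination 3 * hsq a ha b hb
  rw [sum_congr rfl fun a ha ↦ sum_congr rfl (split a ha)]
  simp only [sum_add_distrib, sum_sub_distrib]
  linarith

/-- Each set of four pairwise unrelated elements comes from 24 ordered quadruples. -/
lemma card_powersetCard_four_eq_sum {ι : Type*} [DecidableEq ι] (X : Finset ι)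
    (r : ι → ι → Prop) [DecidableRel r] (hrefl : ∀ a, r a a) (hsymm : ∀ a b, r a b → r b a) :
    (24 : ℚ) * #{S ∈ X.powersetCard 4 | ∀ a ∈ S, ∀ b ∈ S, r a b → a = b} =
      ∑ a ∈ X, ∑ b ∈ X, ∑ e ∈ X, ∑ d ∈ X,
        (1 - if r a b then 1 else 0) * (1 - if r a e then 1 else 0) *
          (1 - if r b e then 1 else 0) * ((1 - if r a d then 1 else 0) *
          (1 - if r b d then 1 else 0) * (1 - if r e d then 1 else 0)) := by
  set Q : Finset (ι × ι × ι × ι) := {q ∈ X ×ˢ X ×ˢ X ×ˢ X |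
    ¬ r q.1 q.2.1 ∧ ¬ r q.1 q.2.2.1 ∧ ¬ r q.2.1 q.2.2.1 ∧ ¬ r q.1 q.2.2.2 ∧
      ¬ r q.2.1 q.2.2.2 ∧ ¬ r q.2.2.1 q.2.2.2} with hQ
  have hsum : (#Q : ℚ) = ∑ a ∈ X, ∑ b ∈ X, ∑ e ∈ X, ∑ d ∈ X,
        (1 - if r a b then 1 else 0) * (1 - if r a e then 1 else 0) *
          (1 - if r b e then 1 else 0) * ((1 - if r a d then 1 else 0) *
          (1 - if r b d then 1 else 0) * (1 - if r e d then 1 else 0)) := by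
    rw [hQ, card_filter]
    push_cast
    simp only [sum_product]
    refine sum_congr rfl fun a _ ↦ sum_congr rfl fun b _ ↦ sum_congr rfl fun e _ ↦
      sum_congr rfl fun d _ ↦ ?_
    by_cases h₁ : r a b <;> by_cases h₂ : r a e <;> by_cases h₃ : r b e <;>
      by_cases h₄ : r a d <;> by_cases h₅ : r b d <;> by_cases h₆ : r e d <;>
      simp [h₁, h₂, h₃, h₄, h₅, h₆]
  rw [← hsum]
  have hmaps : ∀ q ∈ Q, ({q.1, q.2.1, q.2.2.1, q.2.2.2} : Finset ι) ∈
      ({S ∈ X.powersetCard 4 | ∀ a ∈ S, ∀ b ∈ S, r a b → a = b} : Finset (Finset ι)) := by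
    rintro ⟨a, b, e, d⟩ hq
    simp only [hQ, mem_filter, mem_product] at hq
    obtain ⟨⟨ha, hb, he, hd⟩, h₁, h₂, h₃, h₄, h₅, h₆⟩ := hq
    have ne : ∀ {x y}, ¬ r x y → x ≠ y := fun h hxy ↦ h (hxy ▸ hrefl _)
    simp only [mem_filter, mem_powersetCard]
    refine ⟨⟨by simp [insert_subset_iff, *], ?_⟩, ?_⟩
    · rw [card_insert_of_notMem, card_insert_of_notMem, card_insert_of_notMem, card_singleton]
      all_goals simp [*]
    · intro x hx y hy hxy
      simp only [mem_insert, mem_singleton] at hx hy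
      have hyx := hsymm _ _ hxy
      rcases hx with rfl | rfl | rfl | rfl <;> rcases hy with rfl | rfl | rfl | rfl <;>
        first | rfl | contradiction
  rw [card_eq_sum_card_fiberwise hmaps, sum_const_nat (m := 24)]
  · push_cast; ring
  intro S hS
  simp only [mem_filter, mem_powersetCard] at hS
  obtain ⟨⟨hSX, hcard⟩, hS⟩ := hS
  let g : Fin 4 ↪ ι := (S.equivFinOfCardEq hcard).symm.toEmbedding.trans (.subtype _)
  have hg : univ.map g = S := by
    ext x
    simp only [mem_map, mem_univ, true_and]
    constructor
    · rintro ⟨i, rfl⟩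
      exact ((S.equivFinOfCardEq hcard).symm i).2
    · intro hx
      exact ⟨S.equivFinOfCardEq hcard ⟨x, hx⟩, by simp [g]⟩
  have hgS : ∀ i, g i ∈ S := fun i ↦ hg ▸ mem_map_of_mem g (mem_univ i)
  have hfib : ({q ∈ Q | ({q.1, q.2.1, q.2.2.1, q.2.2.2} : Finset ι) = S}) =
      (univ.filter fun v : Fin 4 × Fin 4 × Fin 4 × Fin 4 ↦
        ({v.1, v.2.1, v.2.2.1, v.2.2.2} : Finset (Fin 4)) = univ).map
        (g.prodMap (g.prodMap (g.prodMap g))) := by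
    ext ⟨a, b, e, d⟩
    simp only [mem_filter, mem_map, mem_univ, true_and, Prod.exists,
      Function.Embedding.coe_prodMap, Prod.map_apply, Prod.mk.injEq]
    constructor
    · rintro ⟨-, h⟩
      have hmem : ∀ x ∈ S, ∃ i, g i = x := fun x hx ↦ by simpa [← hg] using hx
      obtain ⟨i, rfl⟩ := hmem a (by simp [← h])
      obtain ⟨j, rfl⟩ := hmem b (by simp [← h])
      obtain ⟨k, rfl⟩ := hmem e (by simp [← h])
      obtain ⟨l, rfl⟩ := hmem d (by simp [← h])
      refine ⟨i, j, k, l, ?_, rfl, rfl, rfl, rfl⟩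
      apply map_injective g
      rw [hg, ← h]
      simp
    · rintro ⟨i, j, k, l, h, rfl, rfl, rfl, rfl⟩
      have hne : i ≠ j ∧ i ≠ k ∧ j ≠ k ∧ i ≠ l ∧ j ≠ l ∧ k ≠ l := by
        revert i j k l
        decide
      have hr : ∀ x y, x ≠ y → ¬ r (g x) (g y) := fun x y hxy h ↦
        hxy (g.injective (hS _ (hgS x) _ (hgS y) h))
      refine ⟨?_, ?_⟩
      · simp only [hQ, mem_filter, mem_product]
        exact ⟨⟨hSX (hgS i), hSX (hgS j), hSX (hgS k), hSX (hgS l)⟩, hr _ _ hne.1,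
          hr _ _ hne.2.1, hr _ _ hne.2.2.1, hr _ _ hne.2.2.2.1, hr _ _ hne.2.2.2.2.1,
          hr _ _ hne.2.2.2.2.2⟩
      · rw [← hg, ← h]
        simp
  rw [hfib, card_map]
  decide

/-- The edge shared by the downward triangle at `e.1` and its neighbour in direction `e.2`. -/
def lozenge (e : (ℕ × ℕ) × Fin 3) : Sym2 (ℕ × ℕ) :=
  ![s((e.1.1 + 1, e.1.2), (e.1.1, e.1.2 + 1)), s((e.1.1 + 1, e.1.2), (e.1.1 + 1, e.1.2 + 1)),
    s((e.1.1, e.1.2 + 1), (e.1.1 + 1, e.1.2 + 1))] e.2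

/-- The corner of the upward triangle containing `lozenge e`. -/
def upCorner (e : (ℕ × ℕ) × Fin 3) : ℕ × ℕ :=
  ![e.1, (e.1.1 + 1, e.1.2), (e.1.1, e.1.2 + 1)] e.2

/-- The corners of the downward triangles of the grid of side `n`. -/
def downCorners (n : ℕ) : Finset (ℕ × ℕ) :=
  (Finset.range n ×ˢ Finset.range n).filter (fun p => p.1 + p.2 + 2 ≤ n)

lemma lozenge_mem_downTri (e : (ℕ × ℕ) × Fin 3) (q : ℕ × ℕ) :
    lozenge e ∈ downTri q ↔ e.1 = q := by
  obtain ⟨⟨a, b⟩, i⟩ := e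
  obtain ⟨c, d⟩ := q
  fin_cases i <;> simp [lozenge, downTri] <;> omega

lemma lozenge_mem_upTri (e : (ℕ × ℕ) × Fin 3) (q : ℕ × ℕ) :
    lozenge e ∈ upTri q ↔ upCorner e = q := by
  obtain ⟨⟨a, b⟩, i⟩ := e
  obtain ⟨c, d⟩ := q
  fin_cases i <;> simp [lozenge, upTri, upCorner] <;> omega

lemma exists_lozenge_of_mem_downTri {x : Sym2 (ℕ × ℕ)} {p : ℕ × ℕ} (h : x ∈ downTri p) :
    ∃ i, lozenge (p, i) = x := by
  simp only [downTri, mem_insert, mem_singleton] at h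
  rcases h with rfl | rfl | rfl
  exacts [⟨0, rfl⟩, ⟨1, rfl⟩, ⟨2, rfl⟩]

lemma upTri_unique {x : Sym2 (ℕ × ℕ)} {p q : ℕ × ℕ} (hp : x ∈ upTri p) (hq : x ∈ upTri q) :
    p = q := by
  obtain ⟨a, b⟩ := p
  obtain ⟨c, d⟩ := q
  simp only [upTri, mem_insert, mem_singleton] at hp hq
  rcases hp with rfl | rfl | rfl <;> simp at hq ⊢ <;> omega

lemma eq_of_corners_eq {e f : (ℕ × ℕ) × Fin 3} (h₁ : e.1 = f.1)
    (h₂ : upCorner e = upCorner f) : e = f := by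
  obtain ⟨⟨a, b⟩, i⟩ := e
  obtain ⟨⟨c, d⟩, j⟩ := f
  fin_cases i <;> fin_cases j <;> simp_all [upCorner]

lemma lozenge_injective : Function.Injective lozenge := fun e f h ↦
  eq_of_corners_eq ((lozenge_mem_downTri e f.1).1 (h ▸ (lozenge_mem_downTri f f.1).2 rfl))
    ((lozenge_mem_upTri e _).1 (h ▸ (lozenge_mem_upTri f _).2 rfl))

lemma mem_upTris {n : ℕ} {t : Finset (Sym2 (ℕ × ℕ))} :
    t ∈ upTris n ↔ ∃ p : ℕ × ℕ, p.1 + p.2 + 1 ≤ n ∧ upTri p = t := by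
  simp only [upTris, mem_image, mem_filter, mem_product, mem_range]
  exact exists_congr fun p ↦ and_congr_left fun _ ↦ by omega

lemma mem_downTris {n : ℕ} {t : Finset (Sym2 (ℕ × ℕ))} :
    t ∈ downTris n ↔ ∃ p ∈ downCorners n, downTri p = t := by
  simp only [downTris, downCorners, mem_image]

lemma mem_downCorners {n : ℕ} {p : ℕ × ℕ} : p ∈ downCorners n ↔ p.1 + p.2 + 2 ≤ n := by
  simp only [downCorners, mem_filter, mem_product, mem_range]
  omega

lemma upCorner_le {n : ℕ} {e : (ℕ × ℕ) × Fin 3} (h : e.1 ∈ downCorners n) :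
    (upCorner e).1 + (upCorner e).2 + 1 ≤ n := by
  rw [mem_downCorners] at h
  obtain ⟨⟨a, b⟩, i⟩ := e
  fin_cases i <;> simp [upCorner] at h ⊢ <;> omega

lemma internalEdges_eq (n : ℕ) :
    internalEdges n = (downCorners n ×ˢ univ).map ⟨lozenge, lozenge_injective⟩ := by
  ext x
  simp only [internalEdges, allEdges, mem_filter, mem_sup, mem_map, mem_product, mem_univ,
    and_true, Function.Embedding.coeFn_mk, id]
  constructor
  · rintro ⟨-, h⟩
    obtain ⟨s, hs, t, ht, hst⟩ := one_lt_card.1 h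
    simp only [mem_filter, unitTris, mem_union] at hs ht
    have key : ∀ t, t ∈ downTris n → x ∈ t → ∃ e : (ℕ × ℕ) × Fin 3,
        e.1 ∈ downCorners n ∧ lozenge e = x := by
      intro t ht hx
      obtain ⟨p, hp, rfl⟩ := mem_downTris.1 ht
      obtain ⟨i, hi⟩ := exists_lozenge_of_mem_downTri hx
      exact ⟨(p, i), hp, hi⟩
    rcases hs with ⟨hs | hs, hxs⟩
    · rcases ht with ⟨ht | ht, hxt⟩
      · obtain ⟨p, -, rfl⟩ := mem_upTris.1 hs
        obtain ⟨q, -, rfl⟩ := mem_upTris.1 ht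
        exact absurd (congrArg upTri (upTri_unique hxs hxt)) hst
      · exact key t ht hxt
    · exact key s hs hxs
  · rintro ⟨e, he, rfl⟩
    have hd : downTri e.1 ∈ unitTris n := mem_union_right _ (mem_downTris.2 ⟨e.1, he, rfl⟩)
    have hu : upTri (upCorner e) ∈ unitTris n :=
      mem_union_left _ (mem_upTris.2 ⟨_, upCorner_le he, rfl⟩)
    have hed := (lozenge_mem_downTri e _).2 rfl
    have heu := (lozenge_mem_upTri e _).2 rfl
    refine ⟨⟨_, hd, hed⟩, one_lt_card.2 ⟨_, mem_filter.2 ⟨hd, hed⟩, _,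
      mem_filter.2 ⟨hu, heu⟩, fun h ↦ ?_⟩⟩
    have h₁ : ∀ i, upCorner (e.1, i) = upCorner e := fun i ↦
      (lozenge_mem_upTri _ _).1 (h ▸ (lozenge_mem_downTri (e.1, i) e.1).2 rfl)
    have h₂ := (h₁ 0).trans (h₁ 1).symm
    simp [upCorner, Prod.ext_iff] at h₂

/-- Two lozenges overlap when they share a downward or an upward unit triangle. -/
def Overlap (e f : (ℕ × ℕ) × Fin 3) : Prop := e.1 = f.1 ∨ upCorner e = upCorner f

instance : DecidableRel Overlap := fun _ _ ↦ inferInstanceAs (Decidable (_ ∨ _))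

lemma L_eq_card_filter (n l : ℕ) : L n l = #{S ∈ (downCorners n ×ˢ univ).powersetCard l |
    ∀ a ∈ S, ∀ b ∈ S, Overlap a b → a = b} := by
  rw [L, internalEdges_eq, powersetCard_map, filter_map, card_map]
  congr 1
  refine filter_congr fun S hS ↦ ?_
  have hSn : ∀ e ∈ S, e.1 ∈ downCorners n := fun e he ↦
    (mem_product.1 ((mem_powersetCard.1 hS).1 he)).1
  simp only [Function.comp_apply, card_le_one, mem_inter,
    RelEmbedding.coe_toEmbedding, mapEmbedding_apply, mem_map, Function.Embedding.coeFn_mk]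
  constructor
  · rintro h a ha b hb (hab | hab)
    · refine lozenge_injective (h _ (mem_union_right _ (mem_downTris.2 ⟨a.1, hSn a ha, rfl⟩))
        _ ⟨(lozenge_mem_downTri _ _).2 rfl, a, ha, rfl⟩
        _ ⟨(lozenge_mem_downTri _ _).2 hab.symm, b, hb, rfl⟩)
    · refine lozenge_injective (h _
        (mem_union_left _ (mem_upTris.2 ⟨upCorner a, upCorner_le (hSn a ha), rfl⟩))
        _ ⟨(lozenge_mem_upTri _ _).2 rfl, a, ha, rfl⟩
        _ ⟨(lozenge_mem_upTri _ _).2 hab.symm, b, hb, rfl⟩)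
  · rintro h t ht _ ⟨hat, a, ha, rfl⟩ _ ⟨hbt, b, hb, rfl⟩
    refine congrArg _ (h a ha b hb ?_)
    rcases mem_union.1 ht with ht | ht
    · obtain ⟨p, -, rfl⟩ := mem_upTris.1 ht
      exact .inr (((lozenge_mem_upTri _ _).1 hat).trans ((lozenge_mem_upTri _ _).1 hbt).symm)
    · obtain ⟨p, -, rfl⟩ := mem_downTris.1 ht
      exact .inl (((lozenge_mem_downTri _ _).1 hat).trans ((lozenge_mem_downTri _ _).1 hbt).symm)

lemma card_downCorners_succ (n : ℕ) : (#(downCorners (n + 1)) : ℚ) = n * (n + 1) / 2 := by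
  induction n with
  | zero => simp [downCorners]
  | succ n ih =>
    have h : downCorners (n + 1 + 1) = downCorners (n + 1) ∪ antidiagonal n := by
      ext p
      simp only [mem_union, mem_downCorners, HasAntidiagonal.mem_antidiagonal]
      omega
    have hd : Disjoint (downCorners (n + 1)) (antidiagonal n) := by
      rw [disjoint_left]
      intro p hp hp'
      rw [mem_downCorners] at hp
      rw [HasAntidiagonal.mem_antidiagonal] at hp'
      omega
    rw [h, card_union_of_disjoint hd, Nat.card_antidiagonal]
    push_cast
    rw [ih]
    ring

/-- The indicator of a proposition, as a rational number. -/
abbrev ind (p : Prop) [Decidable p] : ℚ := if p then 1 else 0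

lemma sum_ind_left (n : ℕ) (hn : 1 ≤ n) : ∑ p ∈ downCorners n, ind (p.1 = 0) = n - 1 := by
  have h : (downCorners n).filter (fun p ↦ p.1 = 0) =
      (range (n - 1)).image fun b ↦ ((0, b) : ℕ × ℕ) := by
    ext ⟨a, b⟩
    simp only [mem_filter, mem_downCorners, mem_image, mem_range, Prod.mk.injEq]
    exact ⟨fun h ↦ ⟨b, by omega, by omega, rfl⟩, by rintro ⟨c, h, rfl, rfl⟩; omega⟩
  rw [sum_boole, h, card_image_of_injective _ (by intro a b; simp), card_range]
  push_cast [hn]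
  rfl

lemma sum_ind_bottom (n : ℕ) (hn : 1 ≤ n) : ∑ p ∈ downCorners n, ind (p.2 = 0) = n - 1 := by
  have h : (downCorners n).filter (fun p ↦ p.2 = 0) =
      (range (n - 1)).image fun a ↦ ((a, 0) : ℕ × ℕ) := by
    ext ⟨a, b⟩
    simp only [mem_filter, mem_downCorners, mem_image, mem_range, Prod.mk.injEq]
    exact ⟨fun h ↦ ⟨a, by omega, rfl, by omega⟩, by rintro ⟨c, h, rfl, rfl⟩; omega⟩
  rw [sum_boole, h, card_image_of_injective _ (by intro a b; simp), card_range]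
  push_cast [hn]
  rfl

lemma sum_ind_diagonal (n : ℕ) (hn : 1 ≤ n) :
    ∑ p ∈ downCorners n, ind (p.1 + p.2 + 2 = n) = n - 1 := by
  have h : (downCorners n).filter (fun p ↦ p.1 + p.2 + 2 = n) =
      (range (n - 1)).image fun a ↦ ((a, n - 2 - a) : ℕ × ℕ) := by
    ext ⟨a, b⟩
    simp only [mem_filter, mem_downCorners, mem_image, mem_range, Prod.mk.injEq]
    exact ⟨fun h ↦ ⟨a, by omega, rfl, by omega⟩, by rintro ⟨c, h, rfl, rfl⟩; omega⟩
  rw [sum_boole, h, card_image_of_injective _ (by intro a b; simp +contextual), card_range]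
  push_cast [hn]
  rfl

lemma sum_ind_eq_one {n : ℕ} (q : ℕ × ℕ) (hq : q ∈ downCorners n) (P : ℕ × ℕ → Prop)
    [DecidablePred P] (h : ∀ p ∈ downCorners n, P p ↔ p = q) :
    ∑ p ∈ downCorners n, ind (P p) = 1 := by
  have : (downCorners n).filter P = {q} := by
    ext p
    rw [mem_filter, mem_singleton]
    exact ⟨fun hp ↦ (h p hp.1).1 hp.2, fun hp ↦ hp ▸ ⟨hq, (h q hq).2 rfl⟩⟩
  rw [sum_boole, this, card_singleton, Nat.cast_one]

/-- A sum over downward triangles, split according to which sides of the grid they touch. -/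
lemma sum_downCorners (n : ℕ) (hn : 3 ≤ n) (Φ : ℚ → ℚ → ℚ → ℚ) :
    ∑ p ∈ downCorners n, Φ (ind (p.1 = 0)) (ind (p.2 = 0)) (ind (p.1 + p.2 + 2 = n)) =
      ((n : ℚ) * (n - 1) / 2 - 3 * (n - 1) + 3) * Φ 0 0 0 +
        (n - 3) * (Φ 1 0 0 + Φ 0 1 0 + Φ 0 0 1) + (Φ 1 1 0 + Φ 1 0 1 + Φ 0 1 1) := by
  have expand : ∀ (x y z : Prop) [Decidable x] [Decidable y] [Decidable z], ¬ (x ∧ y ∧ z) →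
      Φ (ind x) (ind y) (ind z) =
      Φ 0 0 0 * 1 + (Φ 1 0 0 - Φ 0 0 0) * ind x + (Φ 0 1 0 - Φ 0 0 0) * ind y +
        (Φ 0 0 1 - Φ 0 0 0) * ind z +
        (Φ 1 1 0 - Φ 1 0 0 - Φ 0 1 0 + Φ 0 0 0) * ind (x ∧ y) +
        (Φ 1 0 1 - Φ 1 0 0 - Φ 0 0 1 + Φ 0 0 0) * ind (x ∧ z) +
        (Φ 0 1 1 - Φ 0 1 0 - Φ 0 0 1 + Φ 0 0 0) * ind (y ∧ z) := by
    intro x y z _ _ _ h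
    by_cases hx : x <;> by_cases hy : y <;> by_cases hz : z
    · exact absurd ⟨hx, hy, hz⟩ h
    all_goals simp only [ind, hx, hy, hz, and_self, and_true, and_false, if_true, if_false]; ring
  have key : ∀ p ∈ downCorners n,
      Φ (ind (p.1 = 0)) (ind (p.2 = 0)) (ind (p.1 + p.2 + 2 = n)) =
      Φ 0 0 0 * 1 + (Φ 1 0 0 - Φ 0 0 0) * ind (p.1 = 0) + (Φ 0 1 0 - Φ 0 0 0) * ind (p.2 = 0) +
        (Φ 0 0 1 - Φ 0 0 0) * ind (p.1 + p.2 + 2 = n) +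
        (Φ 1 1 0 - Φ 1 0 0 - Φ 0 1 0 + Φ 0 0 0) * ind (p.1 = 0 ∧ p.2 = 0) +
        (Φ 1 0 1 - Φ 1 0 0 - Φ 0 0 1 + Φ 0 0 0) * ind (p.1 = 0 ∧ p.1 + p.2 + 2 = n) +
        (Φ 0 1 1 - Φ 0 1 0 - Φ 0 0 1 + Φ 0 0 0) * ind (p.2 = 0 ∧ p.1 + p.2 + 2 = n) :=
    fun p _ ↦ expand _ _ _ (by omega)
  have hcard : ∑ _p ∈ downCorners n, (1 : ℚ) = n * (n - 1) / 2 := by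
    obtain ⟨k, rfl⟩ : ∃ k, n = k + 1 := ⟨n - 1, by omega⟩
    rw [sum_const, nsmul_one, card_downCorners_succ]
    push_cast
    ring
  have hxy := sum_ind_eq_one (n := n) (0, 0) (mem_downCorners.2 (by simp only; omega))
    (fun p ↦ p.1 = 0 ∧ p.2 = 0) fun p _ ↦ by rw [Prod.ext_iff]
  have hxz := sum_ind_eq_one (n := n) (0, n - 2) (mem_downCorners.2 (by simp only; omega))
    (fun p ↦ p.1 = 0 ∧ p.1 + p.2 + 2 = n) fun p _ ↦ by rw [Prod.ext_iff]; simp only; omega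
  have hyz := sum_ind_eq_one (n := n) (n - 2, 0) (mem_downCorners.2 (by simp only; omega))
    (fun p ↦ p.2 = 0 ∧ p.1 + p.2 + 2 = n) fun p _ ↦ by rw [Prod.ext_iff]; simp only; omega
  rw [sum_congr rfl key]
  simp only [sum_add_distrib, ← mul_sum, hcard, hxy, hxz, hyz, sum_ind_left n (by omega),
    sum_ind_bottom n (by omega), sum_ind_diagonal n (by omega)]
  ring

/-- The number of lozenges covering the upward triangle with corner `u`. -/
def upDegree (n : ℕ) (u : ℕ × ℕ) : ℚ :=
  ∑ f ∈ downCorners n ×ˢ univ, ind (u = upCorner f)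

lemma upDegree_eq (n : ℕ) (u : ℕ × ℕ) : upDegree n u = ind (u.1 + u.2 + 2 ≤ n) +
    ind (1 ≤ u.1 ∧ u.1 + u.2 + 1 ≤ n) + ind (1 ≤ u.2 ∧ u.1 + u.2 + 1 ≤ n) := by
  have point : ∀ (P : ℕ × ℕ → Prop) [DecidablePred P] (C : Prop) [Decidable C] (q : ℕ × ℕ),
      (∀ p ∈ downCorners n, P p ↔ C ∧ p = q) → (C → q ∈ downCorners n) →
      ∑ p ∈ downCorners n, ind (P p) = ind C := by
    intro P _ C _ q h hq
    by_cases hC : C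
    · rw [sum_ind_eq_one q (hq hC) P fun p hp ↦ by simp [h p hp, hC]]
      simp [ind, hC]
    · rw [sum_eq_zero fun p hp ↦ by simp [ind, h p hp, hC]]
      simp [ind, hC]
  rw [upDegree, sum_product]
  simp only [Fin.sum_univ_three, sum_add_distrib]
  obtain ⟨a, b⟩ := u
  congr 1
  · congr 1
    · refine point _ _ (a, b) ?_ ?_
      · rintro ⟨c, d⟩ h
        simp only [mem_downCorners, upCorner, Prod.mk.injEq, Matrix.cons_val] at h ⊢
        omega
      · simp only [mem_downCorners]; omega
    · refine point _ _ (a - 1, b) ?_ ?_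
      · rintro ⟨c, d⟩ h
        simp only [mem_downCorners, upCorner, Prod.mk.injEq, Matrix.cons_val] at h ⊢
        omega
      · simp only [mem_downCorners]; omega
  · refine point _ _ (a, b - 1) ?_ ?_
    · rintro ⟨c, d⟩ h
      simp only [mem_downCorners, upCorner, Prod.mk.injEq, Matrix.cons_val] at h ⊢
      omega
    · simp only [mem_downCorners]; omega

lemma upDegree_upCorner (n : ℕ) (p : ℕ × ℕ) (hp : p ∈ downCorners n) :
    upDegree n (upCorner (p, 0)) = 3 - ind (p.1 = 0) - ind (p.2 = 0) ∧
    upDegree n (upCorner (p, 1)) = 3 - ind (p.2 = 0) - ind (p.1 + p.2 + 2 = n) ∧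
    upDegree n (upCorner (p, 2)) = 3 - ind (p.1 = 0) - ind (p.1 + p.2 + 2 = n) := by
  rw [mem_downCorners] at hp
  simp only [upDegree_eq, upCorner, Matrix.cons_val]
  refine ⟨?_, ?_, ?_⟩ <;> simp only [ind] <;> split_ifs <;> first | omega | norm_num

lemma Overlap.symm {e f : (ℕ × ℕ) × Fin 3} (h : Overlap e f) : Overlap f e :=
  h.imp Eq.symm Eq.symm

lemma ind_overlap (e f : (ℕ × ℕ) × Fin 3) :
    ind (Overlap e f) = ind (e.1 = f.1) + ind (upCorner e = upCorner f) - ind (e = f) := by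
  by_cases h₁ : e.1 = f.1 <;> by_cases h₂ : upCorner e = upCorner f
  · have h := eq_of_corners_eq h₁ h₂
    simp [ind, Overlap, h]
  all_goals
    have h : e ≠ f := by rintro rfl; contradiction
    simp [ind, Overlap, h, h₁, h₂]

lemma sum_ind_fst (n : ℕ) (e : (ℕ × ℕ) × Fin 3) (he : e.1 ∈ downCorners n)
    (g : (ℕ × ℕ) × Fin 3 → ℚ) :
    ∑ f ∈ downCorners n ×ˢ univ, ind (e.1 = f.1) * g f = ∑ i, g (e.1, i) := by
  rw [sum_product, sum_eq_single e.1]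
  · simp [ind]
  · intro p _ hp
    simp [ind, hp.symm]
  · exact fun h ↦ absurd he h

lemma sum_ind_eq (n : ℕ) (e : (ℕ × ℕ) × Fin 3) (he : e.1 ∈ downCorners n)
    (g : (ℕ × ℕ) × Fin 3 → ℚ) :
    ∑ f ∈ downCorners n ×ˢ univ, ind (e = f) * g f = g e := by
  simp [ind, ite_mul, he]

lemma sum_ind_upCorner (n : ℕ) (e : (ℕ × ℕ) × Fin 3) (g : ℕ × ℕ → ℚ) :
    ∑ f ∈ downCorners n ×ˢ univ, ind (upCorner e = upCorner f) * g (upCorner f) =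
      upDegree n (upCorner e) * g (upCorner e) := by
  rw [upDegree, sum_mul]
  refine sum_congr rfl fun f _ ↦ ?_
  by_cases h : upCorner e = upCorner f <;> simp [ind, h]

/-- Weighted count of the lozenges overlapping `e`. -/
lemma sum_overlap_mul (n : ℕ) (e : (ℕ × ℕ) × Fin 3) (he : e.1 ∈ downCorners n) (g : ℕ × ℕ → ℚ) :
    ∑ f ∈ downCorners n ×ˢ univ, ind (Overlap e f) * g (upCorner f) =
      ∑ i, g (upCorner (e.1, i)) + (upDegree n (upCorner e) - 1) * g (upCorner e) := by
  simp only [ind_overlap, add_mul, sub_mul, sum_add_distrib, sum_sub_distrib]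
  rw [sum_ind_fst n e he fun f ↦ g (upCorner f), sum_ind_upCorner,
    sum_ind_eq n e he fun f ↦ g (upCorner f)]
  ring

/-- Three pairwise overlapping lozenges share a common unit triangle. -/
lemma overlap_triple (a b f : (ℕ × ℕ) × Fin 3) :
    ind (Overlap a b) * (ind (Overlap a f) * ind (Overlap b f)) =
      ind (a.1 = b.1) * ind (a.1 = f.1) +
        ind (upCorner a = upCorner b) * ind (upCorner a = upCorner f) -
        ind (a = b) * ind (a = f) := by
  have hab := @eq_of_corners_eq a b
  have haf := @eq_of_corners_eq a f
  have hbf := @eq_of_corners_eq b f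
  simp only [ind, Overlap]
  grind

/-- A lozenge cannot overlap three pairwise non-overlapping ones. -/
lemma overlap_pigeonhole (a b e d : (ℕ × ℕ) × Fin 3) :
    (1 - ind (Overlap a b)) * (1 - ind (Overlap a e)) * (1 - ind (Overlap b e)) *
      (ind (Overlap a d) * ind (Overlap b d) * ind (Overlap e d)) = 0 := by
  simp only [ind, Overlap]
  grind

/-- The honeycomb has no 4-cycles: lozenges that do not overlap have at most one common
neighbour. -/
lemma overlap_common_unique {a b f g : (ℕ × ℕ) × Fin 3} (hab : ¬ Overlap a b)
    (haf : Overlap a f) (hbf : Overlap b f) (hag : Overlap a g) (hbg : Overlap b g) :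
    f = g := by
  simp only [Overlap, not_or] at *
  have key : ∀ x y : (ℕ × ℕ) × Fin 3, x.1 = a.1 → upCorner x = upCorner b → y.1 = b.1 →
      upCorner y = upCorner a → False := by
    rintro ⟨p, i⟩ ⟨q, j⟩ h₁ h₂ h₃ h₄
    obtain ⟨⟨a₁, a₂⟩, k⟩ := a
    obtain ⟨⟨b₁, b₂⟩, l⟩ := b
    simp only at h₁ h₃ hab
    subst h₁ h₃
    fin_cases i <;> fin_cases j <;> fin_cases k <;> fin_cases l <;>
      simp [upCorner] at h₂ h₄ hab <;> omega
  rcases haf with haf | haf <;> rcases hbf with hbf | hbf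
  · exact absurd (haf.trans hbf.symm) hab.1
  · rcases hag with hag | hag <;> rcases hbg with hbg | hbg
    · exact absurd (hag.trans hbg.symm) hab.1
    · exact eq_of_corners_eq (haf.symm.trans hag) (hbf.symm.trans hbg)
    · exact (key f g haf.symm hbf.symm hbg.symm hag.symm).elim
    · exact absurd (hag.trans hbg.symm) hab.2
  · rcases hag with hag | hag <;> rcases hbg with hbg | hbg
    · exact absurd (hag.trans hbg.symm) hab.1
    · exact (key g f hag.symm hbg.symm hbf.symm haf.symm).elim
    · exact eq_of_corners_eq (hbf.symm.trans hbg) (haf.symm.trans hag)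
    · exact absurd (hag.trans hbg.symm) hab.2
  · exact absurd (haf.trans hbf.symm) hab.2

lemma common_sq (X : Finset ((ℕ × ℕ) × Fin 3)) (a b : (ℕ × ℕ) × Fin 3) :
    (1 - ind (Overlap a b)) * (∑ f ∈ X, ind (Overlap a f) * ind (Overlap b f)) ^ 2 =
      (1 - ind (Overlap a b)) * ∑ f ∈ X, ind (Overlap a f) * ind (Overlap b f) := by
  by_cases hab : Overlap a b
  · simp [ind, hab]
  congr 1
  rw [sq, sum_mul_sum]
  refine sum_congr rfl fun f hf ↦ ?_
  rw [sum_eq_single_of_mem f hf]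
  · by_cases h₁ : Overlap a f <;> by_cases h₂ : Overlap b f <;> simp [ind, h₁, h₂]
  · intro g _ hgf
    by_cases h₁ : Overlap a f <;> by_cases h₂ : Overlap b f <;> by_cases h₃ : Overlap a g <;>
      by_cases h₄ : Overlap b g
    · exact absurd (overlap_common_unique hab h₃ h₄ h₁ h₂) hgf
    all_goals simp [ind, h₁, h₂, h₃, h₄]

/-- Number of pairs of lozenges overlapping each other and `a`. -/
lemma sum_triangles (n : ℕ) (a : (ℕ × ℕ) × Fin 3) (ha : a.1 ∈ downCorners n) :
    ∑ b ∈ downCorners n ×ˢ univ, ind (Overlap a b) *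
      ∑ f ∈ downCorners n ×ˢ univ, ind (Overlap a f) * ind (Overlap b f) =
      8 + upDegree n (upCorner a) ^ 2 := by
  simp only [mul_sum, overlap_triple, sum_add_distrib, sum_sub_distrib]
  simp only [← mul_sum, ← sum_mul]
  have h₁ := sum_ind_fst n a ha fun _ ↦ 1
  have h₂ := sum_ind_eq n a ha fun _ ↦ 1
  simp only [mul_one, sum_const, card_univ, Fintype.card_fin] at h₁ h₂
  rw [h₁, h₂, upDegree]
  norm_num
  ring

lemma sum_lozenges (n : ℕ) (hn : 3 ≤ n) (F : ℚ → ℚ → ℚ) :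
    ∑ a ∈ downCorners n ×ˢ univ, F (upDegree n (upCorner a))
        (∑ i, upDegree n (upCorner (a.1, i))) =
      ((n : ℚ) * (n - 1) / 2 - 3 * (n - 1) + 3) * (3 * F 3 9) +
        (n - 3) * (3 * (2 * F 2 7 + F 3 7)) + 3 * (F 1 5 + 2 * F 2 5) := by
  rw [sum_product, sum_congr rfl fun p hp ↦ ?_, sum_downCorners n hn fun x y z ↦
    F (3 - x - y) (9 - 2 * x - 2 * y - 2 * z) + F (3 - y - z) (9 - 2 * x - 2 * y - 2 * z) +
      F (3 - x - z) (9 - 2 * x - 2 * y - 2 * z)]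
  · norm_num
    ring
  · obtain ⟨h₀, h₁, h₂⟩ := upDegree_upCorner n p hp
    simp only [Fin.sum_univ_three, h₀, h₁, h₂]
    ring_nf

lemma twentyfour_mul_L_four (n : ℕ) (hn : 3 ≤ n) : 24 * (L n 4 : ℚ) =
    9 / 16 * ((n : ℚ) - 2) * ((n : ℚ) - 3) *
      (9 * (n : ℚ) ^ 6 + 9 * (n : ℚ) ^ 5 - 135 * (n : ℚ) ^ 4 - 81 * (n : ℚ) ^ 3
        + 670 * (n : ℚ) ^ 2 + 104 * (n : ℚ) - 1216) := by
  set X : Finset ((ℕ × ℕ) × Fin 3) := downCorners n ×ˢ univ with hX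
  have hmem : ∀ a ∈ X, a.1 ∈ downCorners n := fun a ha ↦ (mem_product.1 ha).1
  have hsymm : ∀ a b, ind (Overlap a b) = ind (Overlap b a) := fun a b ↦ by
    simp only [ind, show Overlap a b ↔ Overlap b a from ⟨Overlap.symm, Overlap.symm⟩]
  set κ : (ℕ × ℕ) × Fin 3 → (ℕ × ℕ) × Fin 3 → ℚ := fun a b ↦
    ∑ d ∈ X, ind (Overlap a d) * ind (Overlap b d) with hκ
  set c : (ℕ × ℕ) × Fin 3 → ℚ := fun a ↦ ∑ b ∈ X, ind (Overlap a b) with hc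
  set R : (ℕ × ℕ) × Fin 3 → ℚ := fun a ↦ ∑ b ∈ X, ind (Overlap a b) * c b with hR
  set K : (ℕ × ℕ) × Fin 3 → ℚ := fun a ↦ ∑ b ∈ X, (1 - ind (Overlap a b)) * κ a b with hK
  have c_eq : ∀ a ∈ X, c a = upDegree n (upCorner a) + 2 := by
    intro a ha
    have h := sum_overlap_mul n a (hmem a ha) fun _ ↦ 1
    simp only [mul_one, sum_const, card_univ, Fintype.card_fin] at h
    rw [hc]
    simp only [hX, h]
    norm_num
    ring
  have R_eq : ∀ a ∈ X, R a = ∑ i, upDegree n (upCorner (a.1, i)) + 6 +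
      (upDegree n (upCorner a) - 1) * (upDegree n (upCorner a) + 2) := by
    intro a ha
    have h := sum_overlap_mul n a (hmem a ha) fun u ↦ upDegree n u + 2
    simp only [hR]
    rw [sum_congr rfl fun b hb ↦ by rw [c_eq b hb], h, sum_add_distrib]
    norm_num
  have K_eq : ∀ a ∈ X,
      K a = ∑ i, upDegree n (upCorner (a.1, i)) + upDegree n (upCorner a) - 4 := by
    intro a ha
    have h := sum_triangles n a (hmem a ha)
    have h₂ : ∑ b ∈ X, κ a b = R a := by
      simp only [hκ, hR, hc, mul_sum]
      rw [sum_comm]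
      exact sum_congr rfl fun d _ ↦ sum_congr rfl fun b _ ↦ by rw [hsymm b d]
    simp only [hK, sub_mul, one_mul, sum_sub_distrib, h₂, R_eq a ha]
    rw [h]
    ring
  have hm : ∑ _a ∈ X, (1 : ℚ) = 3 * (n * (n - 1) / 2) :=
    (sum_lozenges n hn fun _ _ ↦ 1).trans (by ring)
  have hC : ∑ a ∈ X, c a = 15 * (n * (n - 1) / 2) - 6 * (n - 1) := by
    rw [sum_congr rfl c_eq]
    exact (sum_lozenges n hn fun d _ ↦ d + 2).trans (by ring)
  rw [L_eq_card_filter, card_powersetCard_four_eq_sum _ Overlap (fun _ ↦ .inl rfl)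
      (fun _ _ ↦ Overlap.symm),
    sum_quadruples_eq_sum_pairs X (fun a b ↦ ind (Overlap a b)) κ c _ hm (fun _ ↦ rfl)
      (fun _ _ ↦ rfl) hsymm (fun a _ b _ e _ d _ ↦ overlap_pigeonhole a b e d),
    sum_pairs_eq_sum X (fun a b ↦ ind (Overlap a b)) κ c K R _ hm (fun _ ↦ rfl)
      (fun _ ↦ rfl) (fun _ ↦ rfl) hsymm
      (fun a b ↦ sum_congr rfl fun _ _ ↦ mul_comm _ _) (fun a _ b _ ↦ common_sq X a b), hC,
    sum_congr rfl fun a ha ↦ by rw [c_eq a ha, R_eq a ha, K_eq a ha]]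
  refine (sum_lozenges n hn fun d s ↦ ((3 * ((n : ℚ) * (n - 1) / 2)) ^ 2
    - 5 * (3 * ((n : ℚ) * (n - 1) / 2)) * (d + 2) + 3 * (d + 2) ^ 2)
      * (3 * ((n : ℚ) * (n - 1) / 2) - (d + 2))
    + 3 * (d + 2) * (15 * ((n : ℚ) * (n - 1) / 2) - 6 * (n - 1) - (s + 6 + (d - 1) * (d + 2)))
    + (4 * (3 * ((n : ℚ) * (n - 1) / 2)) + 3 - 9 * (d + 2)) * (s + d - 4)).trans ?_
  ring

lemma cast_choose_four (m : ℕ) :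
    (m.choose 4 : ℚ) = m * (m - 1) * (m - 2) * (m - 3) / 24 := by
  have h := congrArg (Nat.cast (R := ℚ)) (Nat.descFactorial_eq_factorial_mul_choose m 4)
  rw [← descPochhammer_eval_eq_descFactorial ℚ] at h
  simp [descPochhammer_succ_eval, Nat.factorial] at h
  linarith

lemma cast_three_mul_div_two (n : ℕ) (hn : 1 ≤ n) :
    ((3 * (n - 1) * n / 2 : ℕ) : ℚ) = 3 * (n - 1) * n / 2 := by
  rw [Nat.cast_div _ (by norm_num)]
  · push_cast [hn]
    ring
  · rw [mul_assoc]
    exact Dvd.dvd.mul_left (by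
      obtain ⟨k, rfl⟩ : ∃ k, n = k + 1 := ⟨n - 1, by omega⟩
      exact (Nat.even_mul_succ_self k).two_dvd) 3

/-- Closed form for `L_{n,4}` for `n ≥ 3`, via inclusion–exclusion corrections. -/
theorem L_four (n : ℕ) (hn : 3 ≤ n) :
    (L n 4 : ℚ) = (Nat.choose (3 * (n - 1) * n / 2) 4 : ℚ) -
      (3 * (6 * (n : ℚ) - 11) * ((n : ℚ) - 2)
        + 3 / 2 * ((n : ℚ) - 2) *
          (10 * (n : ℚ) ^ 3 - 20 * (n : ℚ) ^ 2 - 47 * (n : ℚ) + 95)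
        + 3 / 8 * ((n : ℚ) - 2) *
          (9 * (n : ℚ) ^ 5 - 18 * (n : ℚ) ^ 4 - 96 * (n : ℚ) ^ 3
            + 198 * (n : ℚ) ^ 2 + 235 * (n : ℚ) - 520)) ∧
    (L n 4 : ℚ) = 3 / 128 * ((n : ℚ) - 2) * ((n : ℚ) - 3) *
      (9 * (n : ℚ) ^ 6 + 9 * (n : ℚ) ^ 5 - 135 * (n : ℚ) ^ 4 - 81 * (n : ℚ) ^ 3
        + 670 * (n : ℚ) ^ 2 + 104 * (n : ℚ) - 1216) := by
  have h := twentyfour_mul_L_four n hn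
  refine ⟨?_, by linarith⟩
  rw [cast_choose_four, cast_three_mul_div_two n (by omega)]
  linear_combination h / 24
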